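/- There is C > 0 such that for all t ∈ ℝ, all w : ℤ → ℂ with ‖w‖_{H^{−1/2}} < ∞, and all v : ℤ → ℂ with ‖v‖_{H^{1/2}} < ∞: ‖T(w,v)(t)‖_{H^{1/2}} ≤ C ‖w‖_{H^{−1/2}} ‖v‖²_{H^{1/2}}, where T(w,v)(t)_k := ∑_{k₁+k₂+k₃=k, Φ(k̄)≠0} (k/Φ(k̄)) e^{itΦ(k̄)} w_{k₁} v_{k₂} v_{k₃} (absolutely convergent under the stated finiteness assumptions). -/

import Mathlib

open scoped ENNReal

/-- Japanese bracket `⟨k⟩ = 1 + |k|`. -/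
noncomputable def jb (k : ℤ) : ℝ := 1 + |(k : ℝ)|

/-- `‖f‖_{H^s} = (∑_k ⟨k⟩^{2s} |f k|²)^{1/2}`, valued in `[0,∞]`. -/
noncomputable def hnorm (s : ℝ) (f : ℤ → ℂ) : ℝ≥0∞ :=
  (∑' k : ℤ, ENNReal.ofReal (jb k ^ (2 * s) * ‖f k‖ ^ 2)) ^ (1 / 2 : ℝ)

/-- `Φ(k̄) = k³ − k₁³ − k₂³ − k₃³` with `k = k₁ + k₂ + k₃`. -/
def Phi (k₁ k₂ k₃ : ℤ) : ℤ := (k₁ + k₂ + k₃) ^ 3 - k₁ ^ 3 - k₂ ^ 3 - k₃ ^ 3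

/-- The trilinear operator
`T(w,v)(t)_k = ∑_{k₁+k₂+k₃=k, Φ(k̄)≠0} (k/Φ(k̄)) e^{itΦ(k̄)} w_{k₁} v_{k₂} v_{k₃}`. -/
noncomputable def Trilin (w v : ℤ → ℂ) (t : ℝ) (k : ℤ) : ℂ :=
  ∑' p : ℤ × ℤ,
    if Phi p.1 p.2 (k - p.1 - p.2) ≠ 0 then
      ((k : ℂ) / ((Phi p.1 p.2 (k - p.1 - p.2) : ℤ) : ℂ)) *
        Complex.exp (Complex.I * (t : ℂ) * ((Phi p.1 p.2 (k - p.1 - p.2) : ℤ) : ℂ)) *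
        w p.1 * v p.2 * v (k - p.1 - p.2)
    else 0

/-- The one-variable bound `⟨k⟩ / (⟨a⟩² ⟨y⟩) ≤ 2 ⟨a⟩⁻² + ⟨y⟩⁻²` when `⟨k⟩ ≤ ⟨y⟩ + ⟨a⟩`. -/
lemma div_sq_mul_le {K A Y : ℝ} (hA : 0 < A) (hY : 0 < Y) (h : K ≤ Y + A) :
    K / (A ^ 2 * Y) ≤ 2 * (1 / A ^ 2) + 1 / Y ^ 2 := by
  have h1 : K / (A ^ 2 * Y) ≤ (Y + A) / (A ^ 2 * Y) := by gcongr
  have h2 : (Y + A) / (A ^ 2 * Y) = (1 / A) ^ 2 + (1 / A) * (1 / Y) := by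
    field_simp
  have h3 : 1 / A ^ 2 = (1 / A) ^ 2 := by field_simp
  have h4 : 1 / Y ^ 2 = (1 / Y) ^ 2 := by field_simp
  rw [h3, h4]
  nlinarith [sq_nonneg (1 / A - 1 / Y), sq_nonneg (1 / A), sq_nonneg (1 / Y)]

/-- The two-variable bound `⟨k⟩² / (⟨a⟩² ⟨y⟩) ≤ 2 ⟨y⟩⁻¹ + 2 ⟨y⟩ ⟨a⟩⁻²`. -/
lemma sq_div_sq_mul_le {K A Y : ℝ} (hK : 0 ≤ K) (hA : 0 < A) (hY : 0 < Y) (h : K ≤ Y + A) :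
    K ^ 2 / (A ^ 2 * Y) ≤ 2 * (1 / Y) + 2 * (Y / A ^ 2) := by
  have h1 : K ^ 2 ≤ 2 * (A ^ 2 + Y ^ 2) := by nlinarith [sq_nonneg (A - Y)]
  have h2 : K ^ 2 / (A ^ 2 * Y) ≤ 2 * (A ^ 2 + Y ^ 2) / (A ^ 2 * Y) := by gcongr
  refine h2.trans (le_of_eq ?_)
  field_simp

lemma one_div_mul_le {X Y : ℝ} (hX : 0 < X) (hY : 0 < Y) :
    1 / (X * Y) ≤ 1 / X ^ 2 + 1 / Y ^ 2 := by
  have h1 : 1 / (X * Y) = (1 / X) * (1 / Y) := by field_simp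
  have h3 : 1 / X ^ 2 = (1 / X) ^ 2 := by field_simp
  have h4 : 1 / Y ^ 2 = (1 / Y) ^ 2 := by field_simp
  rw [h1, h3, h4]
  nlinarith [sq_nonneg (1 / X - 1 / Y), sq_nonneg (1 / X), sq_nonneg (1 / Y)]

lemma div_mul_sq_le {B X Y : ℝ} (hB : 0 < B) (hX : 0 < X) (h : Y ≤ X + B) :
    Y / (X * B ^ 2) ≤ 2 * (1 / B ^ 2) + 1 / X ^ 2 := by
  rw [mul_comm X]
  exact div_sq_mul_le hB hX h

/-- Sum of the products of inverse squares over pairs of independent linear forms. -/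
noncomputable def pairSum (A B C X Y : ℝ) : ℝ :=
  1 / A ^ 2 * (1 / B ^ 2) + 1 / A ^ 2 * (1 / C ^ 2) + 1 / A ^ 2 * (1 / X ^ 2) +
    1 / B ^ 2 * (1 / C ^ 2) + 1 / B ^ 2 * (1 / X ^ 2) + 1 / B ^ 2 * (1 / Y ^ 2) +
    1 / C ^ 2 * (1 / Y ^ 2) + 1 / X ^ 2 * (1 / Y ^ 2)

lemma mul_div_sq_mul_sq_le {K A B C X Y : ℝ} (hA : 0 < A) (hB : 0 < B)
    (hC : 0 < C) (hY : 0 ≤ Y)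
    (hXC : X ≤ K + C) (hYX : Y ≤ X + B) (hBK : 2 * B ≤ K)
    (hsum : 2 * K ≤ A + B + C) (hAC : A ≤ C) :
    X * Y / (A ^ 2 * B ^ 2 * C ^ 2) ≤ 12 * (1 / A ^ 2 * (1 / B ^ 2)) := by
  have hXY : X * Y ≤ 12 * C ^ 2 := by
    have h1 : X ≤ 3 * C := by linarith
    have h2 : Y ≤ 4 * C := by linarith
    calc X * Y ≤ (3 * C) * (4 * C) := by gcongr
      _ = 12 * C ^ 2 := by ring
  calc X * Y / (A ^ 2 * B ^ 2 * C ^ 2) ≤ 12 * C ^ 2 / (A ^ 2 * B ^ 2 * C ^ 2) := by gcongr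
    _ = _ := by field_simp

/-- The pointwise bound on the squared multiplier. -/
lemma multiplier_le {K N A B C X Y : ℝ} (hK : 0 < K) (hN : 0 < N) (hA : 0 < A) (hB : 0 < B)
    (hC : 0 < C) (hX : 0 < X) (hY : 0 < Y)
    (hKX : K ≤ X + C) (hKY : K ≤ Y + A) (hXC : X ≤ K + C) (hYA : Y ≤ K + A)
    (hNK : N ≤ K + B) (hXY : X ≤ Y + B) (hYX : Y ≤ X + B)
    (hsum : 2 * K ≤ A + B + C) :
    K ^ 3 * N / (A ^ 2 * B ^ 2 * C ^ 2 * X * Y) ≤ 100 * pairSum A B C X Y := by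
  have pAB : 0 < 1 / A ^ 2 * (1 / B ^ 2) := by positivity
  have pAC : 0 < 1 / A ^ 2 * (1 / C ^ 2) := by positivity
  have pAX : 0 < 1 / A ^ 2 * (1 / X ^ 2) := by positivity
  have pBC : 0 < 1 / B ^ 2 * (1 / C ^ 2) := by positivity
  have pBX : 0 < 1 / B ^ 2 * (1 / X ^ 2) := by positivity
  have pBY : 0 < 1 / B ^ 2 * (1 / Y ^ 2) := by positivity
  have pCY : 0 < 1 / C ^ 2 * (1 / Y ^ 2) := by positivity
  have pXY : 0 < 1 / X ^ 2 * (1 / Y ^ 2) := by positivity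
  unfold pairSum
  rcases le_total K (2 * B) with hKB | hBK
  · have hKN : K * N ≤ 6 * B ^ 2 := by
      calc K * N ≤ (2 * B) * (3 * B) := by gcongr; linarith
        _ = 6 * B ^ 2 := by ring
    have h1 : K ^ 3 * N / (A ^ 2 * B ^ 2 * C ^ 2 * X * Y) ≤
        6 * (K / (A ^ 2 * Y) * (K / (C ^ 2 * X))) := by
      calc K ^ 3 * N / (A ^ 2 * B ^ 2 * C ^ 2 * X * Y)
          = K ^ 2 * (K * N) / (A ^ 2 * B ^ 2 * C ^ 2 * X * Y) := by ring
        _ ≤ K ^ 2 * (6 * B ^ 2) / (A ^ 2 * B ^ 2 * C ^ 2 * X * Y) := by gcongr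
        _ = _ := by field_simp
    have h2 : K / (A ^ 2 * Y) * (K / (C ^ 2 * X)) ≤
        (2 * (1 / A ^ 2) + 1 / Y ^ 2) * (2 * (1 / C ^ 2) + 1 / X ^ 2) :=
      mul_le_mul (div_sq_mul_le hA hY hKY) (div_sq_mul_le hC hX hKX) (by positivity)
        (by positivity)
    linarith
  · have h1 : K ^ 3 * N / (A ^ 2 * B ^ 2 * C ^ 2 * X * Y) ≤
        3 / 2 * (K ^ 2 / (A ^ 2 * Y) * (K ^ 2 / (C ^ 2 * X))) * (1 / B ^ 2) := by
      calc K ^ 3 * N / (A ^ 2 * B ^ 2 * C ^ 2 * X * Y)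
          ≤ K ^ 3 * (3 / 2 * K) / (A ^ 2 * B ^ 2 * C ^ 2 * X * Y) := by gcongr; linarith
        _ = _ := by field_simp
    have h2 : K ^ 2 / (A ^ 2 * Y) * (K ^ 2 / (C ^ 2 * X)) ≤
        (2 * (1 / Y) + 2 * (Y / A ^ 2)) * (2 * (1 / X) + 2 * (X / C ^ 2)) :=
      mul_le_mul (sq_div_sq_mul_le hK.le hA hY hKY) (sq_div_sq_mul_le hK.le hC hX hKX)
        (by positivity) (by positivity)
    have h3 : (2 * (1 / Y) + 2 * (Y / A ^ 2)) * (2 * (1 / X) + 2 * (X / C ^ 2)) * (1 / B ^ 2) =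
        4 * (1 / (X * Y) * (1 / B ^ 2)) + 4 * (Y / (X * B ^ 2) * (1 / A ^ 2)) +
          4 * (X / (Y * B ^ 2) * (1 / C ^ 2)) + 4 * (X * Y / (A ^ 2 * B ^ 2 * C ^ 2)) := by
      field_simp
      ring
    have h4 := mul_le_mul_of_nonneg_right h2 (by positivity : 0 ≤ 1 / B ^ 2)
    have h5 := mul_le_mul_of_nonneg_right (one_div_mul_le hX hY) (by positivity : 0 ≤ 1 / B ^ 2)
    have h6 := mul_le_mul_of_nonneg_right (div_mul_sq_le hB hX hYX)
      (by positivity : 0 ≤ 1 / A ^ 2)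
    have h7 := mul_le_mul_of_nonneg_right (div_mul_sq_le hB hY hXY)
      (by positivity : 0 ≤ 1 / C ^ 2)
    have h8 : X * Y / (A ^ 2 * B ^ 2 * C ^ 2) ≤
        12 * (1 / A ^ 2 * (1 / B ^ 2)) + 12 * (1 / B ^ 2 * (1 / C ^ 2)) := by
      rcases le_total A C with hAC | hCA
      · have := mul_div_sq_mul_sq_le hA hB hC hY.le hXC hYX hBK hsum hAC
        linarith
      · have := mul_div_sq_mul_sq_le hC hB hA hX.le hYA hXY hBK (by linarith) hCA
        have e : Y * X / (C ^ 2 * B ^ 2 * A ^ 2) = X * Y / (A ^ 2 * B ^ 2 * C ^ 2) := by ring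
        rw [e] at this
        linarith
    linarith

lemma one_le_jb (n : ℤ) : 1 ≤ jb n := by
  unfold jb; linarith [abs_nonneg (n : ℝ)]

lemma jb_pos (n : ℤ) : 0 < jb n := one_pos.trans_le (one_le_jb n)

lemma jb_le_add {l m n : ℤ} (h : l = m + n ∨ l = m - n ∨ l = n - m) : jb l ≤ jb m + jb n := by
  unfold jb
  rcases h with rfl | rfl | rfl <;> push_cast
  · linarith [abs_add_le (m : ℝ) n]
  · linarith [abs_sub (m : ℝ) n]
  · linarith [abs_sub (n : ℝ) m]

lemma jb_le_two_mul_abs {n : ℤ} (hn : n ≠ 0) : jb n ≤ 2 * |(n : ℝ)| := by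
  have : (1 : ℝ) ≤ |(n : ℝ)| := by exact_mod_cast Int.one_le_abs hn
  unfold jb; linarith

lemma Phi_eq (k₁ k₂ k₃ : ℤ) : Phi k₁ k₂ k₃ = 3 * ((k₁ + k₂) * (k₂ + k₃) * (k₃ + k₁)) := by
  unfold Phi; ring

/-- The weight whose sum over `p` controls the squared multiplier at frequency `k`. -/
noncomputable def weight (k : ℤ) (p : ℤ × ℤ) : ℝ :=
  pairSum (jb (p.1 + p.2)) (jb (k - p.1)) (jb (k - p.2)) (jb p.2) (jb (k - p.1 - p.2))

lemma weight_nonneg (k : ℤ) (p : ℤ × ℤ) : 0 ≤ weight k p := by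
  unfold weight pairSum; positivity

lemma jb_mul_sq_div_Phi_sq_le (k : ℤ) (p : ℤ × ℤ) (h : Phi p.1 p.2 (k - p.1 - p.2) ≠ 0) :
    jb k * ((k : ℝ) ^ 2 / ((Phi p.1 p.2 (k - p.1 - p.2) : ℤ) : ℝ) ^ 2) ≤
      800 * weight k p * ((jb p.1)⁻¹ * jb p.2 * jb (k - p.1 - p.2)) := by
  obtain ⟨m, x⟩ := p
  simp only at h ⊢
  have hΦ : Phi m x (k - m - x) = 3 * ((m + x) * (k - m) * (k - x)) := by
    rw [Phi_eq]; ring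
  rw [hΦ] at h ⊢
  have ha : m + x ≠ 0 := by rintro h0; simp [h0] at h
  have hb : k - m ≠ 0 := by rintro h0; simp [h0] at h
  have hc : k - x ≠ 0 := by rintro h0; simp [h0] at h
  have hK := jb_pos k
  have hN := jb_pos m
  have hA := jb_pos (m + x)
  have hB := jb_pos (k - m)
  have hC := jb_pos (k - x)
  have hX := jb_pos x
  have hY := jb_pos (k - m - x)
  have hsum : 2 * jb k ≤ jb (m + x) + jb (k - m) + jb (k - x) := by
    unfold jb
    have e : 2 * |(k : ℝ)| = |((m + x : ℤ) : ℝ) + ((k - m : ℤ) : ℝ) + ((k - x : ℤ) : ℝ)| := by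
      rw [show 2 * |(k : ℝ)| = |2 * (k : ℝ)| by rw [abs_mul, abs_two]]
      push_cast
      congr 1
      ring
    have := abs_add_three ((m + x : ℤ) : ℝ) ((k - m : ℤ) : ℝ) ((k - x : ℤ) : ℝ)
    linarith
  have main := multiplier_le hK hN hA hB hC hX hY
    (jb_le_add (by omega)) (jb_le_add (by omega)) (jb_le_add (by omega)) (jb_le_add (by omega))
    (jb_le_add (by omega)) (jb_le_add (by omega)) (jb_le_add (by omega)) hsum
  have hk : (k : ℝ) ^ 2 ≤ jb k ^ 2 := by
    rw [← sq_abs]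
    gcongr
    unfold jb; linarith
  have hden : (jb (m + x) ^ 2 * jb (k - m) ^ 2 * jb (k - x) ^ 2) / 8 ≤
      ((3 * ((m + x) * (k - m) * (k - x)) : ℤ) : ℝ) ^ 2 := by
    have e : ((3 * ((m + x) * (k - m) * (k - x)) : ℤ) : ℝ) ^ 2 =
        9 / 64 * ((2 * |((m + x : ℤ) : ℝ)|) ^ 2 * (2 * |((k - m : ℤ) : ℝ)|) ^ 2 *
          (2 * |((k - x : ℤ) : ℝ)|) ^ 2) := by
      simp only [mul_pow, sq_abs]; push_cast; ring
    rw [e]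
    have h1 : jb (m + x) ^ 2 * jb (k - m) ^ 2 * jb (k - x) ^ 2 ≤
        (2 * |((m + x : ℤ) : ℝ)|) ^ 2 * (2 * |((k - m : ℤ) : ℝ)|) ^ 2 *
          (2 * |((k - x : ℤ) : ℝ)|) ^ 2 := by
      gcongr <;> exact jb_le_two_mul_abs ‹_›
    have h0 : 0 ≤ jb (m + x) ^ 2 * jb (k - m) ^ 2 * jb (k - x) ^ 2 := by positivity
    linarith
  calc _ ≤ jb k * (jb k ^ 2 / ((jb (m + x) ^ 2 * jb (k - m) ^ 2 * jb (k - x) ^ 2) / 8)) := by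
        gcongr
    _ = 8 * (jb k ^ 3 * jb m /
          (jb (m + x) ^ 2 * jb (k - m) ^ 2 * jb (k - x) ^ 2 * jb x * jb (k - m - x))) *
          ((jb m)⁻¹ * jb x * jb (k - m - x)) := by field_simp
    _ ≤ 8 * (100 * weight k (m, x)) * ((jb m)⁻¹ * jb x * jb (k - m - x)) := by
        gcongr
        exact main
    _ = _ := by ring

/-- The sequence `⟨n⟩⁻²` with values in `[0,∞]`. -/
noncomputable def invSq (n : ℤ) : ℝ≥0∞ := ENNReal.ofReal (1 / jb n ^ 2)

lemma tsum_invSq_ne_top : ∑' n, invSq n ≠ ⊤ := by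
  have hs : Summable fun n : ℕ => 1 / ((n : ℝ) + 1) ^ 2 := by
    have := (summable_nat_add_iff 1).2 (Real.summable_one_div_nat_pow.2 one_lt_two)
    simpa using this
  have : Summable fun n : ℤ => 1 / jb n ^ 2 := by
    refine Summable.of_nat_of_neg (hs.congr fun n => ?_) (hs.congr fun n => ?_)
    · simp [jb, add_comm]
    · simp [jb, add_comm]
  exact this.tsum_ofReal_ne_top

lemma tsum_invSq_mul_invSq_le (l₁ l₂ : ℤ × ℤ → ℤ)
    (h : Function.Injective fun p => (l₁ p, l₂ p)) :
    ∑' p, invSq (l₁ p) * invSq (l₂ p) ≤ (∑' n, invSq n) ^ 2 := by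
  refine (ENNReal.tsum_comp_le_tsum_of_injective h
    fun q : ℤ × ℤ => invSq q.1 * invSq q.2).trans (le_of_eq ?_)
  rw [ENNReal.tsum_prod']
  simp only [ENNReal.tsum_mul_left, ENNReal.tsum_mul_right, sq]

lemma tsum_weight_le (k : ℤ) :
    ∑' p, ENNReal.ofReal (weight k p) ≤ 8 * (∑' n, invSq n) ^ 2 := by
  have e (p : ℤ × ℤ) : ENNReal.ofReal (weight k p) =
      invSq (p.1 + p.2) * invSq (k - p.1) + invSq (p.1 + p.2) * invSq (k - p.2) +
      invSq (p.1 + p.2) * invSq p.2 + invSq (k - p.1) * invSq (k - p.2) +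
      invSq (k - p.1) * invSq p.2 + invSq (k - p.1) * invSq (k - p.1 - p.2) +
      invSq (k - p.2) * invSq (k - p.1 - p.2) + invSq p.2 * invSq (k - p.1 - p.2) := by
    unfold weight pairSum invSq
    simp only [← ENNReal.ofReal_mul (show 0 ≤ 1 / jb _ ^ 2 by positivity)]
    repeat rw [ENNReal.ofReal_add (by positivity) (by positivity)]
  simp only [e, ENNReal.tsum_add]
  have h8 : 8 * (∑' n, invSq n) ^ 2 = (∑' n, invSq n) ^ 2 + (∑' n, invSq n) ^ 2 +
      (∑' n, invSq n) ^ 2 + (∑' n, invSq n) ^ 2 + (∑' n, invSq n) ^ 2 +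
      (∑' n, invSq n) ^ 2 + (∑' n, invSq n) ^ 2 + (∑' n, invSq n) ^ 2 := by ring
  rw [h8]
  gcongr <;>
  · refine tsum_invSq_mul_invSq_le _ _ ?_
    rintro ⟨a, b⟩ ⟨c, d⟩ h
    simp only [Prod.mk.injEq] at h ⊢
    omega

/-- Cauchy–Schwarz for sums in `[0,∞]`, in the form used for weighted kernels. -/
lemma mul_tsum_sq_le {ι : Type*} {c : ℝ≥0∞} {e f g : ι → ℝ≥0∞}
    (h : ∀ i, c * e i ^ 2 ≤ f i * g i) :
    c * (∑' i, e i) ^ 2 ≤ (∑' i, f i) * ∑' i, g i := by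
  let : MeasurableSpace ι := ⊤
  have hsq (x : ℝ≥0∞) : (x ^ (1 / 2 : ℝ)) ^ 2 = x := by
    rw [← ENNReal.rpow_natCast, ← ENNReal.rpow_mul]; norm_num
  have hsq' (x : ℝ≥0∞) : (x ^ (1 / 2 : ℝ)) ^ (2 : ℝ) = x := by
    rw [← ENNReal.rpow_mul]; norm_num
  have hle (i : ι) : c ^ (1 / 2 : ℝ) * e i ≤ f i ^ (1 / 2 : ℝ) * g i ^ (1 / 2 : ℝ) := by
    rw [← ENNReal.pow_le_pow_left_iff two_ne_zero, mul_pow, mul_pow, hsq, hsq, hsq]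
    exact h i
  have key := ENNReal.lintegral_mul_le_Lp_mul_Lq
    (MeasureTheory.Measure.count : MeasureTheory.Measure ι)
    (p := 2) (q := 2) Real.HolderConjugate.two_two (f := fun i => f i ^ (1 / 2 : ℝ))
    (g := fun i => g i ^ (1 / 2 : ℝ)) (Measurable.of_discrete.aemeasurable)
    (Measurable.of_discrete.aemeasurable)
  simp only [MeasureTheory.lintegral_count, Pi.mul_apply, hsq'] at key
  have h2 : c ^ (1 / 2 : ℝ) * ∑' i, e i ≤
      (∑' i, f i) ^ (1 / 2 : ℝ) * (∑' i, g i) ^ (1 / 2 : ℝ) := by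
    rw [← ENNReal.tsum_mul_left]
    exact (ENNReal.tsum_le_tsum hle).trans key
  have h3 := pow_le_pow_left' h2 2
  rwa [mul_pow, mul_pow, hsq, hsq, hsq] at h3

/-- The terms of the square of the `H^s` norm. -/
noncomputable def hterm (s : ℝ) (f : ℤ → ℂ) (k : ℤ) : ℝ≥0∞ :=
  ENNReal.ofReal (jb k ^ (2 * s) * ‖f k‖ ^ 2)

lemma hnorm_eq (s : ℝ) (f : ℤ → ℂ) : hnorm s f = (∑' k, hterm s f k) ^ (1 / 2 : ℝ) := rfl

lemma hnorm_sq (s : ℝ) (f : ℤ → ℂ) : hnorm s f ^ 2 = ∑' k, hterm s f k := by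
  rw [hnorm_eq, ← ENNReal.rpow_natCast, ← ENNReal.rpow_mul]; norm_num

lemma hterm_half (f : ℤ → ℂ) (k : ℤ) :
    hterm (1 / 2) f k = ENNReal.ofReal (jb k) * ‖f k‖ₑ ^ 2 := by
  rw [hterm, ENNReal.ofReal_mul (by have := jb_pos k; positivity),
    ENNReal.ofReal_pow (norm_nonneg _), ofReal_norm]
  norm_num

lemma hterm_neg_half (f : ℤ → ℂ) (k : ℤ) :
    hterm (-(1 / 2)) f k = ENNReal.ofReal ((jb k)⁻¹) * ‖f k‖ₑ ^ 2 := by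
  rw [hterm, ENNReal.ofReal_mul (by have := jb_pos k; positivity),
    ENNReal.ofReal_pow (norm_nonneg _), ofReal_norm]
  norm_num [Real.rpow_neg_one]

/-- The summand of `Trilin`. -/
noncomputable def trilinTerm (w v : ℤ → ℂ) (t : ℝ) (k : ℤ) (p : ℤ × ℤ) : ℂ :=
  if Phi p.1 p.2 (k - p.1 - p.2) ≠ 0 then
    ((k : ℂ) / ((Phi p.1 p.2 (k - p.1 - p.2) : ℤ) : ℂ)) *
      Complex.exp (Complex.I * (t : ℂ) * ((Phi p.1 p.2 (k - p.1 - p.2) : ℤ) : ℂ)) *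
      w p.1 * v p.2 * v (k - p.1 - p.2)
  else 0

lemma norm_trilinTerm_sq {w v : ℤ → ℂ} {t : ℝ} {k : ℤ} {p : ℤ × ℤ}
    (h : Phi p.1 p.2 (k - p.1 - p.2) ≠ 0) :
    ‖trilinTerm w v t k p‖ ^ 2 =
      (k : ℝ) ^ 2 / ((Phi p.1 p.2 (k - p.1 - p.2) : ℤ) : ℝ) ^ 2 *
        (‖w p.1‖ ^ 2 * ‖v p.2‖ ^ 2 * ‖v (k - p.1 - p.2)‖ ^ 2) := by
  rw [trilinTerm, if_pos h]
  generalize Phi p.1 p.2 (k - p.1 - p.2) = F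
  have he : ‖Complex.exp (Complex.I * (t : ℂ) * (F : ℂ))‖ = 1 := by
    rw [Complex.norm_exp]; simp
  simp only [norm_mul, norm_div, he, Complex.norm_intCast, mul_pow, div_pow, sq_abs]
  ring

lemma jb_mul_enorm_trilinTerm_sq_le (w v : ℤ → ℂ) (t : ℝ) (k : ℤ) (p : ℤ × ℤ) :
    ENNReal.ofReal (jb k) * ‖trilinTerm w v t k p‖ₑ ^ 2 ≤
      ENNReal.ofReal (800 * weight k p) *
        (hterm (-(1 / 2)) w p.1 * hterm (1 / 2) v p.2 * hterm (1 / 2) v (k - p.1 - p.2)) := by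
  by_cases h : Phi p.1 p.2 (k - p.1 - p.2) ≠ 0
  · have hk := jb_pos k
    have h1 := jb_pos p.1
    have h2 := jb_pos p.2
    have h3 := jb_pos (k - p.1 - p.2)
    have hw := weight_nonneg k p
    simp only [hterm_half, hterm_neg_half, ← ofReal_norm,
      ← ENNReal.ofReal_pow (norm_nonneg _)]
    repeat rw [← ENNReal.ofReal_mul (by positivity)]
    apply ENNReal.ofReal_le_ofReal
    rw [norm_trilinTerm_sq h, ← mul_assoc]
    refine (mul_le_mul_of_nonneg_right (jb_mul_sq_div_Phi_sq_le k p h)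
      (by positivity)).trans (le_of_eq ?_)
    ring
  · simp [trilinTerm, if_neg h]

lemma tsum_tsum_conv (W V : ℤ → ℝ≥0∞) :
    ∑' k : ℤ, ∑' p : ℤ × ℤ, W p.1 * V p.2 * V (k - p.1 - p.2) =
      (∑' k, W k) * (∑' k, V k) ^ 2 := by
  rw [ENNReal.tsum_comm]
  have (p : ℤ × ℤ) : ∑' k : ℤ, V (k - p.1 - p.2) = ∑' k, V k := by
    simp only [sub_sub]
    exact (Equiv.subRight (p.1 + p.2)).tsum_eq V
  simp only [ENNReal.tsum_mul_left, this]
  rw [ENNReal.tsum_mul_right, ENNReal.tsum_prod']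
  simp only [ENNReal.tsum_mul_left, ENNReal.tsum_mul_right]
  ring

lemma tsum_hterm_Trilin_le (w v : ℤ → ℂ) (t : ℝ) :
    ∑' k, hterm (1 / 2) (fun k => Trilin w v t k) k ≤
      6400 * (∑' n, invSq n) ^ 2 *
        ((∑' k, hterm (-(1 / 2)) w k) * (∑' k, hterm (1 / 2) v k) ^ 2) := by
  rw [← tsum_tsum_conv, ← ENNReal.tsum_mul_left]
  refine ENNReal.tsum_le_tsum fun k => ?_
  have hweight : ∑' p, ENNReal.ofReal (800 * weight k p) ≤ 6400 * (∑' n, invSq n) ^ 2 := by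
    simp only [ENNReal.ofReal_mul (show (0 : ℝ) ≤ 800 by norm_num), ENNReal.tsum_mul_left]
    calc _ ≤ ENNReal.ofReal 800 * (8 * (∑' n, invSq n) ^ 2) := by
          gcongr; exact tsum_weight_le k
      _ = _ := by rw [← mul_assoc]; norm_num
  rw [hterm_half]
  calc ENNReal.ofReal (jb k) * ‖Trilin w v t k‖ₑ ^ 2
      ≤ ENNReal.ofReal (jb k) * (∑' p, ‖trilinTerm w v t k p‖ₑ) ^ 2 := by
        gcongr; exact enorm_tsum_le_tsum_enorm
    _ ≤ _ := mul_tsum_sq_le (jb_mul_enorm_trilinTerm_sq_le w v t k)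
    _ ≤ _ := by gcongr

/-- `‖T(w,v)(t)‖_{H^{1/2}} ≲ ‖w‖_{H^{-1/2}} ‖v‖²_{H^{1/2}}`. -/
theorem trilinear_smoothing :
    ∃ C > (0 : ℝ), ∀ t : ℝ, ∀ w : ℤ → ℂ, hnorm (-(1 / 2)) w < ⊤ →
      ∀ v : ℤ → ℂ, hnorm (1 / 2) v < ⊤ →
        hnorm (1 / 2) (fun k => Trilin w v t k) ≤
          ENNReal.ofReal C * hnorm (-(1 / 2)) w * hnorm (1 / 2) v ^ 2 := by
  set S := ∑' n, invSq n with hS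
  have hC : 80 * S ≠ ⊤ := ENNReal.mul_ne_top (by norm_num) tsum_invSq_ne_top
  refine ⟨(80 * S).toReal + 1, by positivity, fun t w _ v _ => ?_⟩
  have hCle : 80 * S ≤ ENNReal.ofReal ((80 * S).toReal + 1) :=
    (ENNReal.le_ofReal_iff_toReal_le hC (by positivity)).2 (by linarith)
  calc hnorm (1 / 2) (fun k => Trilin w v t k)
      ≤ 80 * S * hnorm (-(1 / 2)) w * hnorm (1 / 2) v ^ 2 := by
        rw [← ENNReal.pow_le_pow_left_iff two_ne_zero, hnorm_sq]
        refine (tsum_hterm_Trilin_le w v t).trans (le_of_eq ?_)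
        rw [← hnorm_sq, ← hnorm_sq, ← hS]
        ring
    _ ≤ _ := by gcongr
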